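/- Assume L²(Ω₁,ν₁) and L²(Ω₂,ν₂) are infinite-dimensional and K₁ ≠ 0 and K₂ ≠ 0. Then the discrete spectrum σ_d(T) of T is a finite set if and only if both σ_d(K₁) and σ_d(K₂) are finite sets. Moreover (without assuming K₁, K₂ ≠ 0), the essential spectrum σ_e(T) is a finite set if and only if both σ_d(K₁) and σ_d(K₂) are finite sets. -/

import Mathlib

open MeasureTheory Filter Topology Metric

noncomputable section

variable {𝓗 : Type*} [NormedAddCommGroup 𝓗] [InnerProductSpace ℂ 𝓗]

/-- `z` is an isolated point of the set `S`. -/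
def IsIsolatedIn (S : Set ℂ) (z : ℂ) : Prop :=
  z ∈ S ∧ ∃ ε > 0, S ∩ Metric.ball z ε = {z}

/-- Discrete spectrum: the set of isolated points of the spectrum that are eigenvalues of
finite multiplicity. -/
def discreteSpectrum (A : 𝓗 →L[ℂ] 𝓗) : Set ℂ :=
  {z | IsIsolatedIn (spectrum ℂ A) z ∧
    Module.End.HasEigenvalue (A : 𝓗 →ₗ[ℂ] 𝓗) z ∧
    FiniteDimensional ℂ (Module.End.eigenspace (A : 𝓗 →ₗ[ℂ] 𝓗) z)}

/-- Essential spectrum: spectrum minus discrete spectrum. -/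
def essSpectrum (A : 𝓗 →L[ℂ] 𝓗) : Set ℂ :=
  spectrum ℂ A \ discreteSpectrum A

/-- Bottom of the essential spectrum (as a real number). -/
def Emin (A : 𝓗 →L[ℂ] 𝓗) : ℝ :=
  sInf {x : ℝ | (x : ℂ) ∈ essSpectrum A}

/-- The span of all eigenspaces with (real) eigenvalue strictly below `E`; its dimension is
the number of eigenvalues below `E` counted with multiplicity. -/
def eigBelow (A : 𝓗 →L[ℂ] 𝓗) (E : ℝ) : Submodule ℂ 𝓗 :=
  ⨆ t : {t : ℝ // t < E}, Module.End.eigenspace (A : 𝓗 →ₗ[ℂ] 𝓗) ((t : ℝ) : ℂ)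

section Abstract

open scoped InnerProductSpace

variable {H : Type*} [NormedAddCommGroup H] [InnerProductSpace ℂ H] [CompleteSpace H]
  {ι : Type*}

/-- `z` is a cluster point of the family `c`. -/
def ClusterAt (c : ι → ℂ) (z : ℂ) : Prop := ∀ ε > 0, {i | ‖c i - z‖ < ε}.Infinite

lemma diag_inner (u : HilbertBasis ι ℂ H) (T : H →L[ℂ] H) (c : ι → ℂ)
    (hT : ∀ i, T (u i) = c i • u i) (i : ι) (x : H) : ⟪u i, T x⟫_ℂ = c i * ⟪u i, x⟫_ℂ := by
  have h : (innerSL ℂ (u i)) ∘L T = c i • innerSL ℂ (u i) := by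
    refine ContinuousLinearMap.ext_on (s := Set.range u) ?_ ?_
    · rw [Submodule.dense_iff_topologicalClosure_eq_top]; exact u.dense_span
    · rintro _ ⟨j, rfl⟩
      classical
      simp only [ContinuousLinearMap.comp_apply, hT, map_smul, innerSL_apply_apply,
        ContinuousLinearMap.smul_apply, smul_eq_mul, orthonormal_iff_ite.mp u.orthonormal]
      split_ifs with h
      · rw [h]
      · simp
  simpa using congrArg (fun L => L x) h

lemma basis_hasSum_sq (u : HilbertBasis ι ℂ H) (x : H) :
    HasSum (fun i => ‖⟪u i, x⟫_ℂ‖ ^ 2) (‖x‖ ^ 2) := by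
  have h := u.hasSum_inner_mul_inner x x
  have h2 := Complex.reCLM.hasSum h
  convert! h2 using 1
  · ext i
    simp only [Function.comp, Complex.reCLM_apply]
    rw [← inner_conj_symm x (u i), Complex.conj_mul']
    norm_cast
  · simp only [Complex.reCLM_apply]
    rw [inner_self_eq_norm_sq_to_K]; norm_cast

lemma diag_lower (u : HilbertBasis ι ℂ H) (T : H →L[ℂ] H) (c : ι → ℂ)
    (hT : ∀ i, T (u i) = c i • u i) (z : ℂ) (δ : ℝ) (hδ : 0 ≤ δ) (h : ∀ i, δ ≤ ‖z - c i‖) (x : H) :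
    δ * ‖x‖ ≤ ‖z • x - T x‖ := by
  have h1 := (basis_hasSum_sq u x).mul_left (δ ^ 2)
  have h2 := basis_hasSum_sq u (z • x - T x)
  have := hasSum_le (fun i => ?_) h1 h2
  · rw [← mul_pow] at this
    exact le_of_sq_le_sq this (norm_nonneg _) 
  · rw [inner_sub_right, diag_inner u T c hT, inner_smul_right, ← sub_mul, norm_mul, mul_pow]
    gcongr
    exact h i

lemma diag_spectrum_subset (u : HilbertBasis ι ℂ H) (T : H →L[ℂ] H) (c : ι → ℂ)
    (hT : ∀ i, T (u i) = c i • u i) : spectrum ℂ T ⊆ closure (Set.range c) := by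
  intro z hz
  by_contra hcl
  apply hz
  rw [Metric.mem_closure_iff] at hcl
  push Not at hcl
  obtain ⟨δ, hδ, h⟩ := hcl
  have h' : ∀ i, δ ≤ ‖z - c i‖ := fun i => by
    rw [← dist_eq_norm]; exact h _ ⟨i, rfl⟩
  change IsUnit _
  rw [ContinuousLinearMap.isUnit_iff_bijective,
    ContinuousLinearMap.bijective_iff_dense_range_and_antilipschitz]
  constructor
  · rw [eq_top_iff, ← u.dense_span]
    apply Submodule.topologicalClosure_mono
    rw [Submodule.span_le]
    rintro _ ⟨i, rfl⟩
    have hne : z - c i ≠ 0 := norm_pos_iff.mp (hδ.trans_le (h' i))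
    refine ⟨(z - c i)⁻¹ • u i, ?_⟩
    simp only [map_smul, ContinuousLinearMap.coe_coe]
    have : (algebraMap ℂ (H →L[ℂ] H) z - T) (u i) = (z - c i) • u i := by
      simp [Algebra.algebraMap_eq_smul_one, hT, sub_smul]
    rw [this, smul_smul, inv_mul_cancel₀ hne, one_smul]
  · refine ⟨⟨δ⁻¹, by positivity⟩, ?_⟩
    apply ContinuousLinearMap.antilipschitz_of_bound
    intro x
    have := diag_lower u T c hT z δ hδ.le h' x
    simp only [ContinuousLinearMap.sub_apply, Algebra.algebraMap_eq_smul_one,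
      ContinuousLinearMap.smul_apply, ContinuousLinearMap.one_apply]
    change ‖x‖ ≤ δ⁻¹ * _
    rw [inv_mul_eq_div, le_div_iff₀ hδ, mul_comm]
    exact this

lemma diag_hasEigenvalue (u : HilbertBasis ι ℂ H) (T : H →L[ℂ] H) (c : ι → ℂ)
    (hT : ∀ i, T (u i) = c i • u i) (i : ι) :
    Module.End.HasEigenvalue (T : H →ₗ[ℂ] H) (c i) := by
  apply Module.End.hasEigenvalue_of_hasEigenvector (x := u i)
  exact ⟨Module.End.mem_eigenspace_iff.mpr (hT i), u.orthonormal.ne_zero i⟩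

lemma diag_mem_spectrum (u : HilbertBasis ι ℂ H) (T : H →L[ℂ] H) (c : ι → ℂ)
    (hT : ∀ i, T (u i) = c i • u i) (i : ι) : c i ∈ spectrum ℂ T := by
  intro h
  have h2 : IsUnit (algebraMap ℂ (H →L[ℂ] H) (c i) - T) := h
  obtain ⟨S, hS⟩ := h2.exists_left_inv
  have h3 : (algebraMap ℂ (H →L[ℂ] H) (c i) - T) (u i) = 0 := by
    simp [Algebra.algebraMap_eq_smul_one, hT]
  have h4 := congrArg (fun L => L (u i)) hS
  have h5 : S ((algebraMap ℂ (H →L[ℂ] H) (c i) - T) (u i)) = u i := h4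
  rw [h3, map_zero] at h5
  exact u.orthonormal.ne_zero i h5.symm

lemma diag_spectrum (u : HilbertBasis ι ℂ H) (T : H →L[ℂ] H) (c : ι → ℂ)
    (hT : ∀ i, T (u i) = c i • u i) : spectrum ℂ T = closure (Set.range c) := by
  apply (diag_spectrum_subset u T c hT).antisymm
  apply closure_minimal _ (spectrum.isClosed T)
  rintro _ ⟨i, rfl⟩
  exact diag_mem_spectrum u T c hT i

lemma diag_eigenspace_fin (u : HilbertBasis ι ℂ H) (T : H →L[ℂ] H) (c : ι → ℂ)
    (hT : ∀ i, T (u i) = c i • u i) (z : ℂ) :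
    FiniteDimensional ℂ (Module.End.eigenspace (T : H →ₗ[ℂ] H) z) ↔ {i | c i = z}.Finite := by
  constructor
  · intro h
    let v : {i | c i = z} → Module.End.eigenspace (T : H →ₗ[ℂ] H) z := fun i =>
      ⟨u i, Module.End.mem_eigenspace_iff.mpr (by
        have := hT i; rw [i.2] at this; exact this)⟩
    have hv : LinearIndependent ℂ v := by
      apply LinearIndependent.of_comp (Submodule.subtype _)
      exact u.orthonormal.linearIndependent.comp _ Subtype.val_injective
    have := hv.finite
    exact Set.toFinite _
  · intro h
    have hle : Module.End.eigenspace (T : H →ₗ[ℂ] H) z ≤ Submodule.span ℂ (u '' {i | c i = z}) := by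
      intro x hx
      have hx' : T x = z • x := Module.End.mem_eigenspace_iff.mp hx
      have h0 : ∀ i ∉ h.toFinset, u.repr x i • u i = 0 := by
        intro i hi
        have hi' : c i ≠ z := by simpa using hi
        have := diag_inner u T c hT i x
        rw [hx', inner_smul_right] at this
        rw [u.repr_apply_apply]
        have h5 : (c i - z) * ⟪u i, x⟫_ℂ = 0 := by rw [sub_mul, this, sub_self]
        rcases mul_eq_zero.mp h5 with h6 | h6
        · exact absurd (sub_eq_zero.mp h6) hi'
        · rw [h6, zero_smul]
      have := (u.hasSum_repr x).unique (hasSum_sum_of_ne_finset_zero h0)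
      rw [this]
      apply Submodule.sum_mem
      intro i hi
      apply Submodule.smul_mem
      apply Submodule.subset_span
      exact ⟨i, by simpa using hi, rfl⟩
    have : FiniteDimensional ℂ (Submodule.span ℂ (u '' {i | c i = z})) :=
      FiniteDimensional.span_of_finite ℂ (h.image _)
    exact Submodule.finiteDimensional_of_le hle

lemma diag_discrete (u : HilbertBasis ι ℂ H) (T : H →L[ℂ] H) (c : ι → ℂ)
    (hT : ∀ i, T (u i) = c i • u i) (z : ℂ) :
    z ∈ discreteSpectrum T ↔ z ∈ Set.range c ∧ ¬ ClusterAt c z := by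
  constructor
  · rintro ⟨⟨hz, ε, hε, hball⟩, -, hfd⟩
    have key : ∀ i, ‖c i - z‖ < ε → c i = z := by
      intro i hi
      have : c i ∈ spectrum ℂ T ∩ Metric.ball z ε :=
        ⟨diag_mem_spectrum u T c hT i, by rwa [Metric.mem_ball, dist_eq_norm]⟩
      rw [hball] at this
      exact this
    constructor
    · have hz' := diag_spectrum_subset u T c hT hz
      obtain ⟨_, ⟨i, rfl⟩, hi⟩ := Metric.mem_closure_iff.mp hz' ε hε
      exact ⟨i, key i (by rwa [dist_comm, dist_eq_norm] at hi)⟩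
    · intro hcl
      exact hcl ε hε (((diag_eigenspace_fin u T c hT z).mp hfd).subset (fun i hi => key i hi))
  · rintro ⟨⟨i₀, rfl⟩, hn⟩
    unfold ClusterAt at hn
    push Not at hn
    obtain ⟨ε, hε, hfin⟩ := hn
    refine ⟨⟨diag_mem_spectrum u T c hT i₀, ?_⟩, diag_hasEigenvalue u T c hT i₀, ?_⟩
    · have hF : (c '' {i | ‖c i - c i₀‖ < ε} \ {c i₀}).Finite := (hfin.image c).sdiff
      have hmem : (c '' {i | ‖c i - c i₀‖ < ε} \ {c i₀})ᶜ ∈ 𝓝 (c i₀) :=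
        hF.isClosed.isOpen_compl.mem_nhds (by simp)
      obtain ⟨ε', hε', hb⟩ := Metric.mem_nhds_iff.mp hmem
      refine ⟨min ε ε', lt_min hε hε', ?_⟩
      apply Set.Subset.antisymm
      · rintro w ⟨hw, hwb⟩
        have hw' := diag_spectrum_subset u T c hT hw
        have h1 : w ∈ closure (Metric.ball (c i₀) (min ε ε') ∩ Set.range c) :=
          Metric.isOpen_ball.inter_closure ⟨hwb, hw'⟩
        have h2 : Metric.ball (c i₀) (min ε ε') ∩ Set.range c ⊆ {c i₀} := by
          rintro _ ⟨h3, ⟨j, rfl⟩⟩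
          by_contra hne
          have h4 : dist (c j) (c i₀) < min ε ε' := h3
          have h5 := hb (show c j ∈ Metric.ball (c i₀) ε' from h4.trans_le (min_le_right _ _))
          apply h5
          refine ⟨⟨j, ?_, rfl⟩, hne⟩
          rw [Set.mem_ofPred_eq, ← dist_eq_norm]
          exact h4.trans_le (min_le_left _ _)
        have := closure_mono h2 h1
        simpa using this
      · rintro _ rfl
        exact ⟨diag_mem_spectrum u T c hT i₀, Metric.mem_ball_self (lt_min hε hε')⟩
    · rw [diag_eigenspace_fin u T c hT]
      apply hfin.subset
      intro i hi
      have : c i = c i₀ := hi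
      simp [this, hε]

lemma diag_ess (u : HilbertBasis ι ℂ H) (T : H →L[ℂ] H) (c : ι → ℂ)
    (hT : ∀ i, T (u i) = c i • u i) (z : ℂ) :
    z ∈ essSpectrum T ↔ ClusterAt c z := by
  unfold essSpectrum
  rw [Set.mem_sdiff, diag_discrete u T c hT, diag_spectrum u T c hT]
  constructor
  · rintro ⟨h1, h2⟩
    by_contra hn
    apply h2
    refine ⟨?_, hn⟩
    unfold ClusterAt at hn
    push Not at hn
    obtain ⟨ε, hε, hfin⟩ := hn
    have h3 : z ∈ closure (Metric.ball z ε ∩ Set.range c) :=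
      Metric.isOpen_ball.inter_closure ⟨Metric.mem_ball_self hε, h1⟩
    have h4 : Metric.ball z ε ∩ Set.range c ⊆ c '' {i | ‖c i - z‖ < ε} := by
      rintro _ ⟨h5, ⟨j, rfl⟩⟩
      exact ⟨j, by rwa [Metric.mem_ball, dist_eq_norm] at h5, rfl⟩
    have h6 := closure_mono h4 h3
    rw [(hfin.image c).isClosed.closure_eq] at h6
    exact Set.image_subset_range _ _ h6
  · intro h
    refine ⟨?_, fun h' => h'.2 h⟩
    rw [Metric.mem_closure_iff]
    intro ε hε
    obtain ⟨i, hi⟩ := (h ε hε).nonempty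
    exact ⟨c i, ⟨i, rfl⟩, by rw [dist_comm, dist_eq_norm]; exact hi⟩

lemma family_orth_bot {κ : Type*} (V : κ → Submodule ℂ H) (w : κ → Type*)
    (b : ∀ z, HilbertBasis (w z) ℂ (V z))
    (hbot : (⨆ z, V z)ᗮ = ⊥) :
    (Submodule.span ℂ
      (Set.range (fun p : (Σ z, w z) => ((b p.1 p.2 : V p.1) : H))))ᗮ = ⊥ := by
  rw [eq_bot_iff, ← hbot]
  intro x hx
  rw [Submodule.mem_orthogonal] at hx
  rw [← Submodule.iInf_orthogonal, Submodule.mem_iInf]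
  intro z
  rw [Submodule.mem_orthogonal]
  intro y hy
  have hL : ((innerSL ℂ x) ∘L (V z).subtypeL) = 0 := by
    refine ContinuousLinearMap.ext_on (s := Set.range (b z)) ?_ ?_
    · rw [Submodule.dense_iff_topologicalClosure_eq_top]; exact (b z).dense_span
    · rintro _ ⟨j, rfl⟩
      have := hx ((b z j : V z) : H) (Submodule.subset_span ⟨⟨z, j⟩, rfl⟩)
      rw [inner_eq_zero_symm] at this
      exact this
  have := congrArg (fun L => L (⟨y, hy⟩ : V z)) hL
  rw [inner_eq_zero_symm]
  exact this

lemma family_orthonormal {κ : Type*} (V : κ → Submodule ℂ H) (w : κ → Type*)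
    (b : ∀ z, HilbertBasis (w z) ℂ (V z))
    (hof : OrthogonalFamily ℂ (fun z => V z) (fun z => (V z).subtypeₗᵢ)) :
    Orthonormal ℂ (fun p : (Σ z, w z) => ((b p.1 p.2 : V p.1) : H)) :=
  hof.orthonormal_sigma_orthonormal (fun z => (b z).orthonormal)

lemma exists_basis_of_family.{v} {H : Type v} [NormedAddCommGroup H] [InnerProductSpace ℂ H]
    [CompleteSpace H] {κ : Type} (V : κ → Submodule ℂ H)
    (hVc : ∀ z, IsClosed (V z : Set H))
    (hof : OrthogonalFamily ℂ (fun z => V z) (fun z => (V z).subtypeₗᵢ))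
    (hbot : (⨆ z, V z)ᗮ = ⊥) :
    ∃ (ι : Type v) (u : HilbertBasis ι ℂ H) (a : ι → κ), ∀ i, u i ∈ V (a i) := by
  have hcs : ∀ z, CompleteSpace (V z) := fun z => (hVc z).completeSpace_coe
  have hb : ∀ z, ∃ (w : Set (V z)), Nonempty (HilbertBasis w ℂ (V z)) :=
    fun z => by
      obtain ⟨w, b, -⟩ := exists_hilbertBasis ℂ (V z)
      exact ⟨w, ⟨b⟩⟩
  choose w hw using hb
  have b : ∀ z, HilbertBasis (w z) ℂ (V z) := fun z => (hw z).some
  refine ⟨(Σ z, w z), HilbertBasis.mkOfOrthogonalEqBot (family_orthonormal V (fun z => w z) b hof)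
    (family_orth_bot V (fun z => w z) b hbot), fun p => p.1, fun p => ?_⟩
  rw [HilbertBasis.coe_mkOfOrthogonalEqBot]
  exact (b p.1 p.2).2

lemma exists_eigenbasis.{v} {H : Type v} [NormedAddCommGroup H] [InnerProductSpace ℂ H]
    [CompleteSpace H] (K : H →L[ℂ] H) (hsa : IsSelfAdjoint K) (hc : IsCompactOperator K) :
    ∃ (ι : Type v) (u : HilbertBasis ι ℂ H) (a : ι → ℂ), ∀ i, K (u i) = a i • u i := by
  have hsym : (K : H →ₗ[ℂ] H).IsSymmetric := hsa.isSymmetric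
  obtain ⟨ι, u, a, h⟩ := exists_basis_of_family
    (fun z : ℂ => Module.End.eigenspace (K : H →ₗ[ℂ] H) z) (fun z => by
      have : (Module.End.eigenspace (K : H →ₗ[ℂ] H) z : Set H) = {x | K x = z • x} := by
        ext x; exact Module.End.mem_eigenspace_iff
      rw [this]
      exact isClosed_eq K.continuous (by fun_prop))
    hsym.orthogonalFamily_eigenspaces
    (ContinuousLinearMap.orthogonalComplement_iSup_eigenspaces_eq_bot hc hsym)
  exact ⟨ι, u, a, fun i => Module.End.mem_eigenspace_iff.mp (h i)⟩

lemma compact_eigs_finite (K : H →L[ℂ] H) (hc : IsCompactOperator K)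
    (u : HilbertBasis ι ℂ H) (a : ι → ℂ) (hK : ∀ i, K (u i) = a i • u i) (ε : ℝ) (hε : 0 < ε) :
    {i | ε ≤ ‖a i‖}.Finite := by
  by_contra hinf
  have hinf : {i | ε ≤ ‖a i‖}.Infinite := hinf
  have hc' : IsCompactOperator (K : H →ₗ[ℂ] H) := hc
  obtain ⟨S, hS, hsub⟩ := hc'.image_closedBall_subset_compact 1
  have hd : ∀ i j, i ≠ j → ε ≤ ‖a i‖ → ε ≤ ‖K (u i) - K (u j)‖ := by
    intro i j hij hi
    have h1 : ⟪u i, K (u i) - K (u j)⟫_ℂ = a i := by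
      rw [inner_sub_right, hK, hK, inner_smul_right, inner_smul_right, u.orthonormal.2 hij,
        inner_self_eq_norm_sq_to_K, u.orthonormal.1]
      simp
    have h2 := norm_inner_le_norm (𝕜 := ℂ) (u i) (K (u i) - K (u j))
    rw [h1, u.orthonormal.1, one_mul] at h2
    exact hi.trans h2
  have hne : (cofinite ⊓ 𝓟 {i | ε ≤ ‖a i‖}).NeBot := hinf.cofinite_inf_principal_neBot
  have hev : ∀ i, K (u i) ∈ S := fun i => hsub ⟨u i, by simp [u.orthonormal.1], rfl⟩
  obtain ⟨y, -, hy⟩ := hS.exists_mapClusterPt_of_frequently (l := cofinite ⊓ 𝓟 {i | ε ≤ ‖a i‖})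
    (f := fun i => K (u i)) (Eventually.frequently (Eventually.of_forall hev))
  have hfr := hy.frequently (Metric.ball_mem_nhds y (half_pos hε))
  obtain ⟨i, hi1, hi2⟩ := (hfr.and_eventually
    (eventually_inf_principal.mpr (Eventually.of_forall fun i hi => hi) :
      ∀ᶠ i in cofinite ⊓ 𝓟 {i | ε ≤ ‖a i‖}, i ∈ {i | ε ≤ ‖a i‖})).exists
  obtain ⟨j, hj1, hj2⟩ := (hfr.and_eventually
    ((eventually_cofinite_ne i).filter_mono inf_le_left)).exists
  have h1 := hd i j hj2.symm hi2
  rw [← dist_eq_norm] at h1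
  have h2 := dist_triangle_right (K (u i)) (K (u j)) y
  linarith

end Abstract

section Tensor

open scoped InnerProductSpace

variable {α β : Type*} [MeasurableSpace α] [MeasurableSpace β]
  (μ : Measure α) (ν : Measure β) [IsFiniteMeasure μ] [IsFiniteMeasure ν]

lemma tens_memLp (φ : Lp ℂ 2 μ) (ψ : Lp ℂ 2 ν) :
    MemLp (fun p : α × β => φ p.1 * ψ p.2) 2 (μ.prod ν) := by
  have h1 := Lp.memLp φ
  have h2 := Lp.memLp ψ
  have hm : AEStronglyMeasurable (fun p : α × β => φ p.1 * ψ p.2) (μ.prod ν) :=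
    h1.1.comp_fst.mul h2.1.comp_snd
  rw [memLp_two_iff_integrable_sq_norm hm]
  have h3 := (memLp_two_iff_integrable_sq_norm h1.1).mp h1
  have h4 := (memLp_two_iff_integrable_sq_norm h2.1).mp h2
  have := h3.mul_prod h4
  refine this.congr (Eventually.of_forall fun p => ?_)
  simp [mul_pow]

/-- Elementary tensor. -/
def tens (φ : Lp ℂ 2 μ) (ψ : Lp ℂ 2 ν) : Lp ℂ 2 (μ.prod ν) := (tens_memLp μ ν φ ψ).toLp _

lemma tens_coe (φ : Lp ℂ 2 μ) (ψ : Lp ℂ 2 ν) :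
    (tens μ ν φ ψ : α × β → ℂ) =ᵐ[μ.prod ν] fun p => φ p.1 * ψ p.2 := MemLp.coeFn_toLp _

lemma ae_fst {p : α → Prop} (h : ∀ᵐ x ∂μ, p x) : ∀ᵐ z ∂(μ.prod ν), p z.1 :=
  Measure.quasiMeasurePreserving_fst.ae h

lemma ae_snd {p : β → Prop} (h : ∀ᵐ x ∂ν, p x) : ∀ᵐ z ∂(μ.prod ν), p z.2 :=
  Measure.quasiMeasurePreserving_snd.ae h

lemma tens_inner (φ φ' : Lp ℂ 2 μ) (ψ ψ' : Lp ℂ 2 ν) :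
    ⟪tens μ ν φ ψ, tens μ ν φ' ψ'⟫_ℂ = ⟪φ, φ'⟫_ℂ * ⟪ψ, ψ'⟫_ℂ := by
  simp only [L2.inner_def]
  rw [← integral_prod_mul]
  apply integral_congr_ae
  filter_upwards [tens_coe μ ν φ ψ, tens_coe μ ν φ' ψ'] with p h1 h2
  rw [h1, h2]
  simp only [RCLike.inner_apply, map_mul]
  ring

lemma tens_add_left (φ φ' : Lp ℂ 2 μ) (ψ : Lp ℂ 2 ν) :
    tens μ ν (φ + φ') ψ = tens μ ν φ ψ + tens μ ν φ' ψ := by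
  apply Lp.ext
  filter_upwards [tens_coe μ ν (φ + φ') ψ, tens_coe μ ν φ ψ, tens_coe μ ν φ' ψ,
    Lp.coeFn_add (tens μ ν φ ψ) (tens μ ν φ' ψ), ae_fst μ ν (Lp.coeFn_add φ φ')]
    with p h1 h2 h3 h4 h5
  rw [h1, h4, h5, Pi.add_apply, Pi.add_apply, h2, h3, add_mul]

lemma tens_smul_left (c : ℂ) (φ : Lp ℂ 2 μ) (ψ : Lp ℂ 2 ν) :
    tens μ ν (c • φ) ψ = c • tens μ ν φ ψ := by
  apply Lp.ext
  filter_upwards [tens_coe μ ν (c • φ) ψ, tens_coe μ ν φ ψ,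
    Lp.coeFn_smul c (tens μ ν φ ψ), ae_fst μ ν (Lp.coeFn_smul c φ)]
    with p h1 h2 h4 h5
  rw [h1, h4, h5, Pi.smul_apply, Pi.smul_apply, h2, smul_eq_mul, smul_eq_mul, mul_assoc]

lemma tens_add_right (φ : Lp ℂ 2 μ) (ψ ψ' : Lp ℂ 2 ν) :
    tens μ ν φ (ψ + ψ') = tens μ ν φ ψ + tens μ ν φ ψ' := by
  apply Lp.ext
  filter_upwards [tens_coe μ ν φ (ψ + ψ'), tens_coe μ ν φ ψ, tens_coe μ ν φ ψ',
    Lp.coeFn_add (tens μ ν φ ψ) (tens μ ν φ ψ'), ae_snd μ ν (Lp.coeFn_add ψ ψ')]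
    with p h1 h2 h3 h4 h5
  rw [h1, h4, h5, Pi.add_apply, Pi.add_apply, h2, h3, mul_add]

lemma tens_smul_right (c : ℂ) (φ : Lp ℂ 2 μ) (ψ : Lp ℂ 2 ν) :
    tens μ ν φ (c • ψ) = c • tens μ ν φ ψ := by
  apply Lp.ext
  filter_upwards [tens_coe μ ν φ (c • ψ), tens_coe μ ν φ ψ,
    Lp.coeFn_smul c (tens μ ν φ ψ), ae_snd μ ν (Lp.coeFn_smul c ψ)]
    with p h1 h2 h4 h5
  rw [h1, h4, h5, Pi.smul_apply, Pi.smul_apply, h2, smul_eq_mul, smul_eq_mul]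
  ring

lemma tens_norm (φ : Lp ℂ 2 μ) (ψ : Lp ℂ 2 ν) : ‖tens μ ν φ ψ‖ = ‖φ‖ * ‖ψ‖ := by
  have h := tens_inner μ ν φ φ ψ ψ
  simp only [inner_self_eq_norm_sq_to_K] at h
  have h2 : ‖tens μ ν φ ψ‖ ^ 2 = (‖φ‖ * ‖ψ‖) ^ 2 := by
    rw [mul_pow]
    exact_mod_cast h
  exact (sq_eq_sq₀ (norm_nonneg _) (by positivity)).mp h2

/-- Tensoring on the right, as a continuous linear map. -/
def tensL (ψ : Lp ℂ 2 ν) : Lp ℂ 2 μ →L[ℂ] Lp ℂ 2 (μ.prod ν) :=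
  LinearMap.mkContinuous
    { toFun := fun φ => tens μ ν φ ψ
      map_add' := fun φ φ' => tens_add_left μ ν φ φ' ψ
      map_smul' := fun c φ => tens_smul_left μ ν c φ ψ } ‖ψ‖
    (fun φ => by
      change ‖tens μ ν φ ψ‖ ≤ _
      rw [tens_norm, mul_comm])

/-- Tensoring on the left, as a continuous linear map. -/
def tensR (φ : Lp ℂ 2 μ) : Lp ℂ 2 ν →L[ℂ] Lp ℂ 2 (μ.prod ν) :=
  LinearMap.mkContinuous
    { toFun := fun ψ => tens μ ν φ ψ
      map_add' := fun ψ ψ' => tens_add_right μ ν φ ψ ψ'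
      map_smul' := fun c ψ => tens_smul_right μ ν c φ ψ } ‖φ‖
    (fun ψ => by
      change ‖tens μ ν φ ψ‖ ≤ _
      rw [tens_norm])

lemma eq_zero_of_rect (g : Lp ℂ 2 (μ.prod ν))
    (h : ∀ s t, MeasurableSet s → MeasurableSet t → ∫ p in s ×ˢ t, g p ∂(μ.prod ν) = 0) :
    g = 0 := by
  have hg : Integrable g (μ.prod ν) := (Lp.memLp g).integrable (by norm_num)
  have hall : ∀ S : Set (α × β), MeasurableSet S → ∫ p in S, g p ∂(μ.prod ν) = 0 := by
    have huniv : ∫ p, g p ∂(μ.prod ν) = 0 := by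
      have := h Set.univ Set.univ .univ .univ
      simpa using this
    intro S hS
    induction S, hS using MeasurableSpace.induction_on_inter generateFrom_prod.symm
      isPiSystem_prod with
    | empty => simp
    | basic S hS =>
      obtain ⟨s, hs, t, ht, rfl⟩ := hS
      exact h s t hs ht
    | compl S hS ih =>
      have := integral_add_compl hS hg
      rw [ih, huniv, zero_add] at this
      exact this
    | iUnion f hd hm ih =>
      rw [integral_iUnion hm hd hg.integrableOn]
      simp [ih]
  rw [Lp.eq_zero_iff_ae_eq_zero]
  exact hg.ae_eq_zero_of_forall_setIntegral_eq_zero fun S hS _ => hall S hS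

lemma eq_zero_of_orth_tens (g : Lp ℂ 2 (μ.prod ν)) (h : ∀ φ ψ, ⟪g, tens μ ν φ ψ⟫_ℂ = 0) :
    g = 0 := by
  apply eq_zero_of_rect
  intro s t hs ht
  let φ := indicatorConstLp (μ := μ) 2 hs (measure_ne_top _ _) (1 : ℂ)
  let ψ := indicatorConstLp (μ := ν) 2 ht (measure_ne_top _ _) (1 : ℂ)
  have h1 := h φ ψ
  rw [← inner_conj_symm, map_eq_zero, L2.inner_def] at h1
  rw [← integral_indicator (hs.prod ht), ← h1]
  apply integral_congr_ae
  filter_upwards [tens_coe μ ν φ ψ,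
    ae_fst μ ν (indicatorConstLp_coeFn (p := 2) (hs := hs) (hμs := measure_ne_top μ s)
      (c := (1 : ℂ))),
    ae_snd μ ν (indicatorConstLp_coeFn (p := 2) (hs := ht) (hμs := measure_ne_top ν t)
      (c := (1 : ℂ)))] with p h2 h3 h4
  rw [h2]
  change _ = ⟪indicatorConstLp (μ := μ) 2 hs (measure_ne_top _ _) (1 : ℂ) p.1 *
    indicatorConstLp (μ := ν) 2 ht (measure_ne_top _ _) (1 : ℂ) p.2, _⟫_ℂ
  rw [h3, h4]
  by_cases hp1 : p.1 ∈ s <;> by_cases hp2 : p.2 ∈ t <;> simp [Set.indicator, hp1, hp2]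

lemma exists_tensor_basis {ι κ : Type*} (u : HilbertBasis ι ℂ (Lp ℂ 2 μ))
    (v : HilbertBasis κ ℂ (Lp ℂ 2 ν)) :
    ∃ w : HilbertBasis (ι × κ) ℂ (Lp ℂ 2 (μ.prod ν)), ∀ p, w p = tens μ ν (u p.1) (v p.2) := by
  have hon : Orthonormal ℂ (fun p : ι × κ => tens μ ν (u p.1) (v p.2)) := by
    classical
    rw [orthonormal_iff_ite]
    rintro ⟨i, j⟩ ⟨i', j'⟩
    rw [tens_inner, orthonormal_iff_ite.mp u.orthonormal, orthonormal_iff_ite.mp v.orthonormal]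
    by_cases h1 : i = i' <;> by_cases h2 : j = j' <;> simp [h1, h2]
  have hbot : (Submodule.span ℂ (Set.range fun p : ι × κ => tens μ ν (u p.1) (v p.2)))ᗮ = ⊥ := by
    rw [eq_bot_iff]
    intro g hg
    rw [Submodule.mem_orthogonal] at hg
    rw [Submodule.mem_bot]
    apply eq_zero_of_orth_tens
    have h0 : ∀ i j, ⟪g, tens μ ν (u i) (v j)⟫_ℂ = 0 := by
      intro i j
      rw [inner_eq_zero_symm]
      exact hg _ (Submodule.subset_span ⟨(i, j), rfl⟩)
    have h1 : ∀ φ j, ⟪g, tens μ ν φ (v j)⟫_ℂ = 0 := by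
      intro φ j
      have hL : (innerSL ℂ g) ∘L (tensL μ ν (v j)) = 0 := by
        refine ContinuousLinearMap.ext_on (s := Set.range u) ?_ ?_
        · rw [Submodule.dense_iff_topologicalClosure_eq_top]; exact u.dense_span
        · rintro _ ⟨i, rfl⟩
          exact h0 i j
      exact congrArg (fun L => L φ) hL
    intro φ ψ
    have hL : (innerSL ℂ g) ∘L (tensR μ ν φ) = 0 := by
      refine ContinuousLinearMap.ext_on (s := Set.range v) ?_ ?_
      · rw [Submodule.dense_iff_topologicalClosure_eq_top]; exact v.dense_span
      · rintro _ ⟨j, rfl⟩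
        exact h1 φ j
    exact congrArg (fun L => L ψ) hL
  exact ⟨HilbertBasis.mkOfOrthogonalEqBot hon hbot, fun p => by
    rw [HilbertBasis.coe_mkOfOrthogonalEqBot]⟩

lemma T1_tens (k : α → α → ℂ) (K : Lp ℂ 2 μ →L[ℂ] Lp ℂ 2 μ)
    (T : Lp ℂ 2 (μ.prod ν) →L[ℂ] Lp ℂ 2 (μ.prod ν))
    (hK : ∀ φ : Lp ℂ 2 μ, (K φ : α → ℂ) =ᵐ[μ] fun x => ∫ s, k x s * φ s ∂μ)
    (hT : ∀ f : Lp ℂ 2 (μ.prod ν),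
      (T f : α × β → ℂ) =ᵐ[μ.prod ν] fun p => ∫ s, k p.1 s * f (s, p.2) ∂μ)
    (φ : Lp ℂ 2 μ) (ψ : Lp ℂ 2 ν) : T (tens μ ν φ ψ) = tens μ ν (K φ) ψ := by
  apply Lp.ext
  have h0 : ∀ᵐ y ∂ν, ∀ᵐ x ∂μ, tens μ ν φ ψ (x, y) = φ x * ψ y := by
    have h := tens_coe μ ν φ ψ
    exact Measure.ae_ae_of_ae_prod
      ((Measure.measurePreserving_swap (μ := ν) (ν := μ)).quasiMeasurePreserving.ae h)
  filter_upwards [hT (tens μ ν φ ψ), tens_coe μ ν (K φ) ψ, ae_fst μ ν (hK φ), ae_snd μ ν h0]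
    with p h1 h2 h3 h4
  rw [h1, h2, h3, ← integral_mul_const]
  apply integral_congr_ae
  filter_upwards [h4] with s hs
  rw [hs, mul_assoc]

lemma T2_tens (k : β → β → ℂ) (K : Lp ℂ 2 ν →L[ℂ] Lp ℂ 2 ν)
    (T : Lp ℂ 2 (μ.prod ν) →L[ℂ] Lp ℂ 2 (μ.prod ν))
    (hK : ∀ φ : Lp ℂ 2 ν, (K φ : β → ℂ) =ᵐ[ν] fun x => ∫ s, k x s * φ s ∂ν)
    (hT : ∀ f : Lp ℂ 2 (μ.prod ν),
      (T f : α × β → ℂ) =ᵐ[μ.prod ν] fun p => ∫ t, k p.2 t * f (p.1, t) ∂ν)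
    (φ : Lp ℂ 2 μ) (ψ : Lp ℂ 2 ν) : T (tens μ ν φ ψ) = tens μ ν φ (K ψ) := by
  apply Lp.ext
  have h0 : ∀ᵐ x ∂μ, ∀ᵐ y ∂ν, tens μ ν φ ψ (x, y) = φ x * ψ y :=
    Measure.ae_ae_of_ae_prod (tens_coe μ ν φ ψ)
  filter_upwards [hT (tens μ ν φ ψ), tens_coe μ ν φ (K ψ), ae_snd μ ν (hK ψ), ae_fst μ ν h0]
    with p h1 h2 h3 h4
  rw [h1, h2, h3, ← integral_const_mul]
  apply integral_congr_ae
  filter_upwards [h4] with s hs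
  rw [hs]
  ring

end Tensor

section Comb

variable {ι κ : Type*}

lemma c0_not_cluster (a : ι → ℂ) (ha : ∀ ε > 0, {i | ε ≤ ‖a i‖}.Finite) (z : ℂ) (hz : z ≠ 0) :
    ¬ ClusterAt a z := by
  intro h
  have hz' : 0 < ‖z‖ := norm_pos_iff.mpr hz
  refine h (‖z‖ / 2) (by positivity) ((ha (‖z‖ / 2) (by positivity)).subset ?_)
  intro i hi
  have hi : ‖a i - z‖ < ‖z‖ / 2 := hi
  have := norm_sub_norm_le z (a i)
  rw [norm_sub_rev] at this
  change ‖z‖ / 2 ≤ ‖a i‖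
  linarith

lemma c0_cluster_zero [Infinite ι] (a : ι → ℂ) (ha : ∀ ε > 0, {i | ε ≤ ‖a i‖}.Finite) :
    ClusterAt a 0 := by
  intro ε hε
  have := (ha ε hε).infinite_compl
  convert this using 1
  ext i
  simp

lemma c0_discrete [Infinite ι] (a : ι → ℂ) (ha : ∀ ε > 0, {i | ε ≤ ‖a i‖}.Finite) (z : ℂ) :
    (z ∈ Set.range a ∧ ¬ ClusterAt a z) ↔ z ∈ Set.range a \ {0} := by
  constructor
  · rintro ⟨h1, h2⟩
    refine ⟨h1, ?_⟩
    rintro rfl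
    exact h2 (c0_cluster_zero a ha)
  · rintro ⟨h1, h2⟩
    exact ⟨h1, c0_not_cluster a ha z h2⟩

lemma cluster_prod_left [Infinite κ] (a : ι → ℂ) (b : κ → ℂ)
    (hb : ∀ ε > 0, {i | ε ≤ ‖b i‖}.Finite) (i : ι) :
    ClusterAt (fun p : ι × κ => a p.1 + b p.2) (a i) := by
  intro ε hε
  have h := c0_cluster_zero b hb ε hε
  refine (h.image (f := fun j => (i, j)) (fun _ _ _ _ h => (Prod.ext_iff.mp h).2)).mono ?_
  rintro _ ⟨j, hj, rfl⟩
  have hj : ‖b j - 0‖ < ε := hj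
  change ‖a i + b j - a i‖ < ε
  simpa using hj

lemma cluster_prod_right [Infinite ι] (a : ι → ℂ) (b : κ → ℂ)
    (ha : ∀ ε > 0, {i | ε ≤ ‖a i‖}.Finite) (j : κ) :
    ClusterAt (fun p : ι × κ => a p.1 + b p.2) (b j) := by
  intro ε hε
  have h := c0_cluster_zero a ha ε hε
  refine (h.image (f := fun i => (i, j)) (fun _ _ _ _ h => (Prod.ext_iff.mp h).1)).mono ?_
  rintro _ ⟨i, hi, rfl⟩
  have hi : ‖a i - 0‖ < ε := hi
  change ‖a i + b j - b j‖ < ε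
  simpa using hi

/-- A point off the range and not a cluster point is at positive distance. -/
lemma not_cluster_gap (a : ι → ℂ) (z : ℂ) (h : ¬ ClusterAt a z) (hr : z ∉ Set.range a) :
    ∃ ε > 0, ∀ i, ε ≤ ‖a i - z‖ := by
  unfold ClusterAt at h
  push Not at h
  obtain ⟨ε, hε, hfin⟩ := h
  have hmem : (a '' {i | ‖a i - z‖ < ε})ᶜ ∈ 𝓝 z :=
    (hfin.image a).isClosed.isOpen_compl.mem_nhds
      (fun h => hr (Set.image_subset_range _ _ h))
  obtain ⟨δ, hδ, hb⟩ := Metric.mem_nhds_iff.mp hmem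
  refine ⟨min ε δ, lt_min hε hδ, fun i => ?_⟩
  by_contra hlt
  push Not at hlt
  have h1 : a i ∈ Metric.ball z δ := by
    rw [Metric.mem_ball, dist_eq_norm]; exact hlt.trans_le (min_le_right _ _)
  exact hb h1 ⟨i, hlt.trans_le (min_le_left _ _), rfl⟩

lemma not_cluster_prod (a : ι → ℂ) (b : κ → ℂ)
    (ha : ∀ ε > 0, {i | ε ≤ ‖a i‖}.Finite) (hb : ∀ ε > 0, {i | ε ≤ ‖b i‖}.Finite)
    (z : ℂ) (hz : z ≠ 0) (hza : z ∉ Set.range a) (hzb : z ∉ Set.range b) :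
    ¬ ClusterAt (fun p : ι × κ => a p.1 + b p.2) z := by
  obtain ⟨ε₁, h1, ha'⟩ := not_cluster_gap a z (c0_not_cluster a ha z hz) hza
  obtain ⟨ε₂, h2, hb'⟩ := not_cluster_gap b z (c0_not_cluster b hb z hz) hzb
  intro hcl
  have hm : 0 < min ε₁ ε₂ / 2 := half_pos (lt_min h1 h2)
  refine hcl _ hm (((ha _ hm).prod (hb _ hm)).subset ?_)
  rintro ⟨i, j⟩ hij
  have hij : ‖a i + b j - z‖ < min ε₁ ε₂ / 2 := hij
  have e1 := min_le_left ε₁ ε₂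
  have e2 := min_le_right ε₁ ε₂
  constructor
  · change min ε₁ ε₂ / 2 ≤ ‖a i‖
    have t1 : ‖b j - z‖ ≤ ‖a i + b j - z‖ + ‖a i‖ := by
      have := norm_sub_le (a i + b j - z) (a i)
      rwa [show a i + b j - z - a i = b j - z by ring] at this
    linarith [hb' j]
  · change min ε₁ ε₂ / 2 ≤ ‖b j‖
    have t1 : ‖a i - z‖ ≤ ‖a i + b j - z‖ + ‖b j‖ := by
      have := norm_sub_le (a i + b j - z) (b j)
      rwa [show a i + b j - z - b j = a i - z by ring] at this
    linarith [ha' i]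

lemma c0_shift_finite (a : ι → ℂ) (ha : ∀ ε > 0, {i | ε ≤ ‖a i‖}.Finite) (b : κ → ℂ)
    (hb : ∀ ε > 0, {i | ε ≤ ‖b i‖}.Finite) (w : ℂ) (hw : w ≠ 0) :
    {z | z ∈ Set.range a ∧ z + w ∈ Set.range b}.Finite := by
  have hw' : 0 < ‖w‖ := norm_pos_iff.mpr hw
  have h1 := ((ha (‖w‖ / 2) (by positivity)).image a)
  have h2 := ((hb (‖w‖ / 2) (by positivity)).image (fun j => b j - w))
  refine (h1.union h2).subset ?_
  rintro _ ⟨⟨i, rfl⟩, ⟨j, hj⟩⟩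
  by_cases h : ‖w‖ / 2 ≤ ‖a i‖
  · left; exact ⟨i, h, rfl⟩
  · right
    refine ⟨j, ?_, by simp [hj]⟩
    change ‖w‖ / 2 ≤ ‖b j‖
    have := norm_sub_le (a i + w) (a i)
    rw [show a i + w - a i = w by ring, ← hj] at this
    linarith

lemma discrete_prod_infinite (a : ι → ℂ) (b : κ → ℂ)
    (ha : ∀ ε > 0, {i | ε ≤ ‖a i‖}.Finite) (hb : ∀ ε > 0, {i | ε ≤ ‖b i‖}.Finite)
    (hinf : (Set.range a).Infinite) (j : κ) (hj : b j ≠ 0) :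
    {z | z ∈ Set.range (fun p : ι × κ => a p.1 + b p.2) ∧
      ¬ ClusterAt (fun p : ι × κ => a p.1 + b p.2) z}.Infinite := by
  have h1 := c0_shift_finite a ha a ha (b j) hj
  have h2 := c0_shift_finite a ha b hb (b j) hj
  have h3 := hinf.sdiff ((h1.union h2).union (Set.finite_singleton (-b j)))
  refine (h3.image (f := fun z => z + b j) (fun x _ y _ h => add_right_cancel h)).mono ?_
  rintro _ ⟨_, ⟨⟨i, rfl⟩, hn⟩, rfl⟩
  refine ⟨⟨(i, j), rfl⟩, ?_⟩
  apply not_cluster_prod a b ha hb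
  · intro h0
    exact hn (Or.inr (eq_neg_of_add_eq_zero_left h0))
  · intro h0
    exact hn (Or.inl (Or.inl ⟨⟨i, rfl⟩, h0⟩))
  · intro h0
    exact hn (Or.inl (Or.inr ⟨⟨i, rfl⟩, h0⟩))

lemma clusterAt_swap (a : ι → ℂ) (b : κ → ℂ) (z : ℂ)
    (h : ClusterAt (fun p : ι × κ => a p.1 + b p.2) z) :
    ClusterAt (fun p : κ × ι => b p.1 + a p.2) z := by
  intro ε hε
  refine ((h ε hε).image (f := Prod.swap) Prod.swap_injective.injOn).mono ?_
  rintro _ ⟨⟨i, j⟩, hp, rfl⟩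
  have hp : ‖a i + b j - z‖ < ε := hp
  change ‖b j + a i - z‖ < ε
  rwa [add_comm]

lemma range_prod_finite (a : ι → ℂ) (b : κ → ℂ) (ha : (Set.range a).Finite)
    (hb : (Set.range b).Finite) :
    (Set.range (fun p : ι × κ => a p.1 + b p.2)).Finite := by
  refine ((ha.prod hb).image (fun p => p.1 + p.2)).subset ?_
  rintro _ ⟨⟨i, j⟩, rfl⟩
  exact ⟨(a i, b j), ⟨⟨i, rfl⟩, ⟨j, rfl⟩⟩, rfl⟩

end Comb

lemma infinite_index {H : Type*} [NormedAddCommGroup H] [InnerProductSpace ℂ H]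
    {ι : Type*} (u : HilbertBasis ι ℂ H) (h : ¬ FiniteDimensional ℂ H) : Infinite ι := by
  by_contra hfin
  rw [not_infinite_iff_finite] at hfin
  have : Fintype ι := Fintype.ofFinite ι
  exact h (u.toOrthonormalBasis.toBasis.finiteDimensional_of_finite)

lemma exists_ne_zero_eig {H : Type*} [NormedAddCommGroup H] [InnerProductSpace ℂ H]
    {ι : Type*} (u : HilbertBasis ι ℂ H) (K : H →L[ℂ] H) (a : ι → ℂ)
    (hu : ∀ i, K (u i) = a i • u i) (h : K ≠ 0) : ∃ i, a i ≠ 0 := by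
  by_contra hn
  push Not at hn
  apply h
  refine ContinuousLinearMap.ext_on (s := Set.range u) ?_ ?_
  · rw [Submodule.dense_iff_topologicalClosure_eq_top]; exact u.dense_span
  · rintro _ ⟨i, rfl⟩
    simp [hu, hn]

section Setting

variable {d₁ d₂ : ℕ}
  {Ω₁ : Set (EuclideanSpace ℝ (Fin d₁))} {Ω₂ : Set (EuclideanSpace ℝ (Fin d₂))}

/-- **Proposition 3.2.** Assuming `K₁ ≠ 0` and `K₂ ≠ 0`, the discrete spectrum of
`T = T₁ + T₂` is finite iff both `σ_d(K₁)` and `σ_d(K₂)` are finite; moreover (without that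
assumption) the essential spectrum of `T` is finite iff both `σ_d(K₁)` and `σ_d(K₂)` are
finite. -/
theorem discreteSpectrum_T_finite_iff
    (ν₁ : Measure Ω₁) (ν₂ : Measure Ω₂) [IsFiniteMeasure ν₁] [IsFiniteMeasure ν₂]
    (k₁ : Ω₁ → Ω₁ → ℂ) (k₂ : Ω₂ → Ω₂ → ℂ)
    (K₁ : Lp ℂ 2 ν₁ →L[ℂ] Lp ℂ 2 ν₁) (K₂ : Lp ℂ 2 ν₂ →L[ℂ] Lp ℂ 2 ν₂)
    (T₁ T₂ : Lp ℂ 2 (ν₁.prod ν₂) →L[ℂ] Lp ℂ 2 (ν₁.prod ν₂))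
    (hΩ₁ : IsCompact Ω₁) (hΩ₂ : IsCompact Ω₂)
    (hk₁c : Continuous fun p : Ω₁ × Ω₁ => k₁ p.1 p.2)
    (hk₂c : Continuous fun p : Ω₂ × Ω₂ => k₂ p.1 p.2)
    (hk₁h : ∀ x s, k₁ x s = starRingEnd ℂ (k₁ s x))
    (hk₂h : ∀ y t, k₂ y t = starRingEnd ℂ (k₂ t y))
    (hK₁ : ∀ φ : Lp ℂ 2 ν₁, (K₁ φ : Ω₁ → ℂ) =ᵐ[ν₁] fun x => ∫ s, k₁ x s * φ s ∂ν₁)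
    (hK₂ : ∀ φ : Lp ℂ 2 ν₂, (K₂ φ : Ω₂ → ℂ) =ᵐ[ν₂] fun y => ∫ t, k₂ y t * φ t ∂ν₂)
    (hK₁sa : IsSelfAdjoint K₁) (hK₂sa : IsSelfAdjoint K₂)
    (hK₁cpt : IsCompactOperator K₁) (hK₂cpt : IsCompactOperator K₂)
    (hT₁ : ∀ f : Lp ℂ 2 (ν₁.prod ν₂),
      (T₁ f : Ω₁ × Ω₂ → ℂ) =ᵐ[ν₁.prod ν₂] fun p => ∫ s, k₁ p.1 s * f (s, p.2) ∂ν₁)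
    (hT₂ : ∀ f : Lp ℂ 2 (ν₁.prod ν₂),
      (T₂ f : Ω₁ × Ω₂ → ℂ) =ᵐ[ν₁.prod ν₂] fun p => ∫ t, k₂ p.2 t * f (p.1, t) ∂ν₂)
    (hinf₁ : ¬ FiniteDimensional ℂ (Lp ℂ 2 ν₁))
    (hinf₂ : ¬ FiniteDimensional ℂ (Lp ℂ 2 ν₂)) :
    ((K₁ ≠ 0 → K₂ ≠ 0 →
      ((discreteSpectrum (T₁ + T₂)).Finite ↔
        (discreteSpectrum K₁).Finite ∧ (discreteSpectrum K₂).Finite)) ∧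
     ((essSpectrum (T₁ + T₂)).Finite ↔
        (discreteSpectrum K₁).Finite ∧ (discreteSpectrum K₂).Finite)) := by
  obtain ⟨ι, u, a, hu⟩ := exists_eigenbasis K₁ hK₁sa hK₁cpt
  obtain ⟨κ, v, b, hv⟩ := exists_eigenbasis K₂ hK₂sa hK₂cpt
  have hι : Infinite ι := infinite_index u hinf₁
  have hκ : Infinite κ := infinite_index v hinf₂
  have ha := compact_eigs_finite K₁ hK₁cpt u a hu
  have hb := compact_eigs_finite K₂ hK₂cpt v b hv
  obtain ⟨w, hw⟩ := exists_tensor_basis ν₁ ν₂ u v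
  have hT : ∀ p, (T₁ + T₂) (w p) = (a p.1 + b p.2) • w p := by
    intro p
    rw [add_apply, hw, T1_tens ν₁ ν₂ k₁ K₁ T₁ hK₁ hT₁,
      T2_tens ν₁ ν₂ k₂ K₂ T₂ hK₂ hT₂, hu, hv, tens_smul_left, tens_smul_right, add_smul]
  have hd1 : discreteSpectrum K₁ = Set.range a \ {0} := by
    ext z; rw [diag_discrete u K₁ a hu, c0_discrete a ha]
  have hd2 : discreteSpectrum K₂ = Set.range b \ {0} := by
    ext z; rw [diag_discrete v K₂ b hv, c0_discrete b hb]
  have hf1 : (discreteSpectrum K₁).Finite ↔ (Set.range a).Finite := by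
    rw [hd1]; exact ⟨fun h => h.of_sdiff (Set.finite_singleton 0), fun h => h.sdiff⟩
  have hf2 : (discreteSpectrum K₂).Finite ↔ (Set.range b).Finite := by
    rw [hd2]; exact ⟨fun h => h.of_sdiff (Set.finite_singleton 0), fun h => h.sdiff⟩
  have hdT : discreteSpectrum (T₁ + T₂) =
      {z | z ∈ Set.range (fun p : ι × κ => a p.1 + b p.2) ∧
        ¬ ClusterAt (fun p : ι × κ => a p.1 + b p.2) z} := by
    ext z; exact diag_discrete w (T₁ + T₂) (fun p => a p.1 + b p.2) hT z
  have heT := diag_ess w (T₁ + T₂) (fun p => a p.1 + b p.2) hT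
  have hsT := diag_spectrum w (T₁ + T₂) (fun p => a p.1 + b p.2) hT
  have hspec : (Set.range a).Finite → (Set.range b).Finite → (spectrum ℂ (T₁ + T₂)).Finite := by
    intro h1 h2
    have h3 := range_prod_finite a b h1 h2
    rw [hsT, h3.isClosed.closure_eq]
    exact h3
  rw [hf1, hf2]
  constructor
  · intro hne1 hne2
    constructor
    · intro hfin
      rw [hdT] at hfin
      constructor
      · by_contra hinf
        obtain ⟨j, hj⟩ := exists_ne_zero_eig v K₂ b hv hne2
        exact discrete_prod_infinite a b ha hb hinf j hj hfin
      · by_contra hinf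
        obtain ⟨i, hi⟩ := exists_ne_zero_eig u K₁ a hu hne1
        refine discrete_prod_infinite b a hb ha hinf i hi (hfin.subset ?_)
        rintro _ ⟨⟨⟨j, i'⟩, rfl⟩, hn⟩
        exact ⟨⟨(i', j), add_comm _ _⟩, fun h => hn (clusterAt_swap a b _ h)⟩
    · rintro ⟨h1, h2⟩
      exact (hspec h1 h2).subset (fun z hz => hz.1.1)
  · constructor
    · intro hfin
      constructor
      · refine hfin.subset ?_
        rintro _ ⟨i, rfl⟩
        exact (heT _).mpr (cluster_prod_left a b hb i)
      · refine hfin.subset ?_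
        rintro _ ⟨j, rfl⟩
        exact (heT _).mpr (cluster_prod_right a b ha j)
    · rintro ⟨h1, h2⟩
      exact (hspec h1 h2).subset Set.sdiff_subset

end Setting

end
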